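/- For every ℓ with 0 ≤ ℓ ≤ j-1 one has ⁅e_ℓ, f_ℓ⁆ = (-1)^{ℓ+1} • C(j-1, ℓ) • ( (j-ℓ)•h₁ + (ℓ+1)•h₂ ), where C(j-1,ℓ) is the binomial coefficient. (Identity (L:2) of Theorem 2.8 of the paper.) -/

import Mathlib

section PowAd

variable {L : Type*} [LieRing L] [LieAlgebra ℂ L]

lemma ad_pow_succ_apply (x v : L) (l : ℕ) :
    (LieAlgebra.ad ℂ L x ^ (l + 1)) v = ⁅x, (LieAlgebra.ad ℂ L x ^ l) v⁆ := by
  rw [pow_succ', Module.End.mul_apply, LieAlgebra.ad_apply]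

lemma lie_ad_pow_of_weight {h x v : L} {a b : ℂ} (hx : ⁅h, x⁆ = a • x) (hv : ⁅h, v⁆ = b • v)
    (l : ℕ) :
    ⁅h, (LieAlgebra.ad ℂ L x ^ l) v⁆ = (b + l * a) • (LieAlgebra.ad ℂ L x ^ l) v := by
  induction l with
  | zero => simpa using hv
  | succ l ih =>
    rw [ad_pow_succ_apply, leibniz_lie, hx, ih, smul_lie, lie_smul, ← add_smul]
    push_cast
    ring_nf

lemma lie_ad_pow_succ_of_highest_weight {h x y v : L} {μ : ℂ} (hyx : ⁅y, x⁆ = h)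
    (hx : ⁅h, x⁆ = (-2 : ℂ) • x) (hv : ⁅h, v⁆ = μ • v) (hyv : ⁅y, v⁆ = 0) (l : ℕ) :
    ⁅y, (LieAlgebra.ad ℂ L x ^ (l + 1)) v⁆ =
      ((l + 1) * (μ - l)) • (LieAlgebra.ad ℂ L x ^ l) v := by
  induction l with
  | zero => simp [leibniz_lie y x v, hyx, hv, hyv]
  | succ l ih =>
    rw [ad_pow_succ_apply x v (l + 1), leibniz_lie, hyx, ih, lie_ad_pow_of_weight hx hv, lie_smul,
      ← ad_pow_succ_apply, ← add_smul]
    push_cast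
    ring_nf

end PowAd

lemma signed_factorial_sq_mul_choose_succ (n l : ℕ) :
    (-1 : ℂ) ^ (l + 1 + 1) * ((l + 1).factorial : ℂ) ^ 2 * (n.choose (l + 1) : ℂ) =
      -((l + 1) * (n - l)) * ((-1 : ℂ) ^ (l + 1) * (l.factorial : ℂ) ^ 2 * (n.choose l : ℂ)) := by
  have key : (n.choose (l + 1) : ℂ) * (l + 1) = n.choose l * (n - l) := by
    rcases le_or_gt l n with h | h
    · have := Nat.choose_succ_right_eq n l
      rw [← Nat.cast_sub h]
      exact_mod_cast this
    · simp [Nat.choose_eq_zero_of_lt h, Nat.choose_eq_zero_of_lt (Nat.lt_succ_of_lt h)]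
  rw [Nat.factorial_succ]
  push_cast
  linear_combination ((-1 : ℂ) ^ l * (l + 1) * (l.factorial : ℂ) ^ 2) * key


theorem monster_L2 {L : Type*} [LieRing L] [LieAlgebra ℂ L]
    (j : ℕ) (hj : 1 ≤ j)
    (eneg fneg h₁ h₂ e f : L)
    (rel_hh : ⁅h₁, h₂⁆ = 0)
    (rel_h1eneg : ⁅h₁, eneg⁆ = eneg) (rel_h2eneg : ⁅h₂, eneg⁆ = -eneg)
    (rel_h1fneg : ⁅h₁, fneg⁆ = -fneg) (rel_h2fneg : ⁅h₂, fneg⁆ = fneg)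
    (rel_h1e : ⁅h₁, e⁆ = e) (rel_h2e : ⁅h₂, e⁆ = (j : ℂ) • e)
    (rel_h1f : ⁅h₁, f⁆ = -f) (rel_h2f : ⁅h₂, f⁆ = -((j : ℂ) • f))
    (rel_enegfneg : ⁅eneg, fneg⁆ = h₁ - h₂)
    (rel_enegf : ⁅eneg, f⁆ = 0) (rel_efneg : ⁅e, fneg⁆ = 0)
    (rel_ef : ⁅e, f⁆ = -((j : ℂ) • h₁ + h₂))
    (rel_serre_e : (LieAlgebra.ad ℂ L eneg ^ j) e = 0)
    (rel_serre_f : (LieAlgebra.ad ℂ L fneg ^ j) f = 0)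
    (eV fV : ℕ → L)
    (heV : ∀ ℓ : ℕ, eV ℓ = ((ℓ.factorial : ℂ))⁻¹ • (LieAlgebra.ad ℂ L eneg ^ ℓ) e)
    (hfV : ∀ ℓ : ℕ, fV ℓ = ((ℓ.factorial : ℂ))⁻¹ • (LieAlgebra.ad ℂ L fneg ^ ℓ) f) :
    ∀ ℓ : ℕ, ℓ ≤ j - 1 →
      ⁅eV ℓ, fV ℓ⁆ =
        ((-1 : ℂ) ^ (ℓ + 1) * ((j - 1).choose ℓ : ℂ)) •
          (((j : ℂ) - (ℓ : ℂ)) • h₁ + ((ℓ : ℂ) + 1) • h₂) := by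
  obtain ⟨n, rfl⟩ : ∃ n, j = n + 1 := ⟨j - 1, by omega⟩
  push_cast at rel_h2e rel_h2f rel_ef ⊢
  have lower_e := lie_ad_pow_succ_of_highest_weight (y := fneg) (x := eneg) (h := h₂ - h₁) (v := e)
    (μ := n) (by rw [← lie_skew, rel_enegfneg]; abel)
    (by rw [sub_lie, rel_h1eneg, rel_h2eneg]; module)
    (by rw [sub_lie, rel_h1e, rel_h2e]; module)
    (by rw [← lie_skew, rel_efneg, neg_zero])
  have lower_f := lie_ad_pow_succ_of_highest_weight (y := eneg) (x := fneg) (h := h₁ - h₂) (v := f)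
    (μ := n) rel_enegfneg
    (by rw [sub_lie, rel_h1fneg, rel_h2fneg]; module)
    (by rw [sub_lie, rel_h1f, rel_h2f]; module)
    rel_enegf
  have fneg_h₁ : ⁅fneg, h₁⁆ = fneg := by rw [← lie_skew, rel_h1fneg, neg_neg]
  have fneg_h₂ : ⁅fneg, h₂⁆ = -fneg := by rw [← lie_skew, rel_h2fneg]
  set A : ℕ → L := fun l => (LieAlgebra.ad ℂ L eneg ^ l) e with hA
  set B : ℕ → L := fun l => (LieAlgebra.ad ℂ L fneg ^ l) f with hB
  have A_succ (l : ℕ) : A (l + 1) = ⁅eneg, A l⁆ := ad_pow_succ_apply _ _ _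
  have B_succ (l : ℕ) : B (l + 1) = ⁅fneg, B l⁆ := ad_pow_succ_apply _ _ _
  replace lower_e (l : ℕ) : ⁅fneg, A (l + 1)⁆ = (((l : ℂ) + 1) * (n - l)) • A l := lower_e l
  replace lower_f (l : ℕ) : ⁅eneg, B (l + 1)⁆ = (((l : ℂ) + 1) * (n - l)) • B l := lower_f l
  set K : ℕ → ℂ := fun l => (-1 : ℂ) ^ (l + 1) * (l.factorial : ℂ) ^ 2 * (n.choose l : ℂ) with hK
  have K_succ (l : ℕ) : K (l + 1) = -((l + 1) * (n - l)) * K l :=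
    signed_factorial_sq_mul_choose_succ n l
  have lie_A_B_succ (l : ℕ) : ⁅A l, B (l + 1)⁆ = ⁅fneg, ⁅A l, B l⁆⁆ - ⁅⁅fneg, A l⁆, B l⁆ := by
    rw [B_succ, leibniz_lie fneg (A l)]
    abel
  have main (l : ℕ) :
      ⁅A l, B l⁆ = K l • (((n : ℂ) + 1 - l) • h₁ + ((l : ℂ) + 1) • h₂) ∧
      ⁅A l, B (l + 1)⁆ = (K l * ((l + 1) * (n - l))) • fneg := by
    induction l with
    | zero =>
      have h0 : ⁅A 0, B 0⁆ = -(((n : ℂ) + 1) • h₁ + h₂) := by simpa [hA, hB] using rel_ef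
      have hf : ⁅fneg, A 0⁆ = 0 := by simpa [hA, rel_efneg] using (lie_skew fneg e).symm
      refine ⟨by rw [h0]; simp [hK, add_comm], ?_⟩
      rw [lie_A_B_succ, h0, hf, zero_lie, lie_neg, lie_add, lie_smul, fneg_h₁, fneg_h₂]
      simp only [hK, zero_add, pow_one, Nat.factorial_zero, Nat.choose_zero_right, Nat.cast_zero,
        Nat.cast_one]
      module
    | succ l ih =>
      obtain ⟨ih₁, ih₂⟩ := ih
      have diag : ⁅A (l + 1), B (l + 1)⁆ =
          K (l + 1) • (((n : ℂ) + 1 - (l + 1 : ℕ)) • h₁ + (((l + 1 : ℕ) : ℂ) + 1) • h₂) := by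
        rw [A_succ, lie_lie, ih₂, lower_f, lie_smul, lie_smul, ih₁, rel_enegfneg, K_succ]
        push_cast
        module
      refine ⟨diag, ?_⟩
      rw [lie_A_B_succ, diag, lower_e, smul_lie, ih₂, lie_smul, lie_add, lie_smul, lie_smul,
        fneg_h₁, fneg_h₂, K_succ]
      push_cast
      module
  intro l _
  have hl : (l.factorial : ℂ) ≠ 0 := Nat.cast_ne_zero.mpr l.factorial_ne_zero
  rw [heV, hfV, smul_lie, lie_smul]
  change _ • _ • ⁅A l, B l⁆ = _
  rw [(main l).1, smul_smul, smul_smul]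
  congr 1
  simp only [hK]
  field_simp
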